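/- The set of all combinatorial commutative semigroup varieties is definable in the lattice Com. Moreover, a commutative semigroup variety is combinatorial if and only if it does not contain the variety A_p for any prime p. -/

import Mathlib

open FirstOrder

/-! ### Words, identities, and commutative semigroup varieties -/

/-- Semigroup words over the countable alphabet `ℕ`. -/
abbrev SGWord : Type := FreeSemigroup ℕ

/-- A semigroup identity `u = v` is a pair of words. -/
abbrev SGId : Type := SGWord × SGWord

/-- The one-letter word consisting of the letter `n`. -/
def ltr (n : ℕ) : SGWord := FreeSemigroup.of n

/-- `wpow w n` is the word `w^n` (for `n ≥ 1`; by convention `wpow w 0 = w`). -/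
def wpow (w : SGWord) : ℕ → SGWord
  | 0 => w
  | 1 => w
  | n + 2 => wpow w (n + 1) * w

/-- The letter `n` occurs in the word `w`. -/
def OccursIn (n : ℕ) (w : SGWord) : Prop := n = w.head ∨ n ∈ w.tail

/-- A semigroup `S` satisfies the identity `i.1 = i.2` if all evaluations of the two
words in `S` coincide. -/
def SGSatisfies (S : Type) [Semigroup S] (i : SGId) : Prop :=
  ∀ f : ℕ → S, FreeSemigroup.lift f i.1 = FreeSemigroup.lift f i.2

/-- A bundled (nonempty) commutative semigroup. -/
structure ComSG where
  carrier : Type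
  [str : CommSemigroup carrier]
  [instNonempty : Nonempty carrier]

attribute [instance] ComSG.str ComSG.instNonempty

/-- The class of commutative semigroups satisfying every identity in `E`. -/
def modelsOf (E : Set SGId) : Set ComSG := {S | ∀ i ∈ E, SGSatisfies S.carrier i}

/-- The set of identities holding in every member of the class `K`. -/
def theoryOfClass (K : Set ComSG) : Set SGId := {i | ∀ S ∈ K, SGSatisfies S.carrier i}

theorem subset_theoryOfClass_modelsOf (E : Set SGId) : E ⊆ theoryOfClass (modelsOf E) :=
  fun i hi S hS => hS i hi

theorem theoryOfClass_antitone {K K' : Set ComSG} (h : K ⊆ K') :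
    theoryOfClass K' ⊆ theoryOfClass K := fun _ hi S hS => hi S (h hS)

theorem modelsOf_antitone {E E' : Set SGId} (h : E ⊆ E') : modelsOf E' ⊆ modelsOf E :=
  fun _ hS i hi => hS i (h hi)

/-- A variety of commutative semigroups, identified with its (equationally closed)
equational theory.  Varieties are ordered by inclusion of the corresponding classes
of semigroups, i.e. by *reverse* inclusion of theories. -/
structure ComVariety where
  theory : Set SGId
  closed : theoryOfClass (modelsOf theory) = theory

theorem ComVariety.ext' {V W : ComVariety} (h : V.theory = W.theory) : V = W := by
  cases V; cases W; cases h; rfl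

instance : PartialOrder ComVariety where
  le V W := W.theory ⊆ V.theory
  le_refl V := subset_rfl
  le_trans U V W h1 h2 := fun i hi => h1 (h2 hi)
  le_antisymm V W h1 h2 := ComVariety.ext' (subset_antisymm h2 h1)

instance : SupSet ComVariety where
  sSup s :=
    { theory := ⋂ V ∈ s, V.theory
      closed := by
        apply subset_antisymm
        · intro i hi
          refine Set.mem_iInter₂.2 fun V hV => ?_
          have h1 : (⋂ V ∈ s, ComVariety.theory V) ⊆ V.theory := Set.biInter_subset_of_mem hV
          have h2 := theoryOfClass_antitone (modelsOf_antitone h1)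
          rw [V.closed] at h2
          exact h2 hi
        · exact subset_theoryOfClass_modelsOf _ }

/-- The lattice **Com** of all commutative semigroup varieties. -/
instance : CompleteLattice ComVariety :=
  completeLatticeOfSup ComVariety fun s => by
    constructor
    · intro V hV i hi
      exact Set.mem_iInter₂.1 hi V hV
    · intro W hW i hi
      exact Set.mem_iInter₂.2 fun V hV => hW hV hi

/-- The variety of commutative semigroups given by the identity system `E`. -/
def comVar (E : Set SGId) : ComVariety where
  theory := theoryOfClass (modelsOf E)
  closed := by
    apply subset_antisymm
    · exact theoryOfClass_antitone fun S hS i hi => hi S hS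
    · exact subset_theoryOfClass_modelsOf _

/-! ### The first-order language of lattices and definability -/

/-- The first-order language of lattices: two binary function symbols (`true` for the
join `∨` and `false` for the meet `∧`) and nothing else. -/
def latticeLang : Language where
  Functions := fun n => match n with | 2 => Bool | _ => Empty
  Relations := fun _ => Empty

instance latticeLangStructure (L : Type*) [Lattice L] : latticeLang.Structure L where
  funMap {n} f x :=
    match n, f with
    | 2, b => bif b then x 0 ⊔ x 1 else x 0 ⊓ x 1
    | 0, f => f.elim
    | 1, f => f.elim
    | (_ + 3), f => f.elim
  RelMap {n} r _ := r.elim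

/-- A subset `A` of a lattice `L` is definable in `L` if there is a first-order formula
`φ(x)` with one free variable in the language of the lattice operations `∨` and `∧`
such that for every `a ∈ L`, `φ(a)` holds in `L` if and only if `a ∈ A`. -/
def LatDefinable (L : Type*) [Lattice L] (A : Set L) : Prop :=
  ∃ φ : latticeLang.Formula (Fin 1), ∀ a : L, (φ.Realize fun _ => a) ↔ a ∈ A

/-! ### Named varieties -/

/-- The commutativity identity `xy = yx`. -/
def commId : SGId := (ltr 0 * ltr 1, ltr 1 * ltr 0)

/-- The pair of identities abbreviated by the symbolic identity `w = 0`, namely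
`wx = w` and `xw = w`, where `x` is the letter `n` (assumed not to occur in `w`). -/
def zeroId (w : SGWord) (n : ℕ) : Set SGId := {(w * ltr n, w), (ltr n * w, w)}

/-- `A n = var{xⁿy = y, xy = yx}`, the variety of Abelian groups of exponent dividing `n`. -/
def Avar (n : ℕ) : ComVariety := comVar {(wpow (ltr 0) n * ltr 1, ltr 1), commId}

/-- `SL = var{x² = x, xy = yx}`, the variety of semilattices. -/
def SLvar : ComVariety := comVar {(wpow (ltr 0) 2, ltr 0), commId}

/-- `ZM = var{xy = 0}` (within **Com**), the variety of null semigroups. -/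
def ZMvar : ComVariety := comVar ({commId} ∪ zeroId (ltr 0 * ltr 1) 2)

/-- `T = var{x = y}`, the trivial variety. -/
def Tvar : ComVariety := comVar {(ltr 0, ltr 1)}

/-- `COM`, the variety of all commutative semigroups. -/
def COMvar : ComVariety := comVar {commId}

/-- `C m = var{xᵐ = xᵐ⁺¹, xy = yx}` (the variety generated by the cyclic monoid
`⟨a ∣ aᵐ = aᵐ⁺¹⟩`), with the convention `C 0 = T`. -/
def Cvar : ℕ → ComVariety
  | 0 => Tvar
  | m + 1 => comVar {(wpow (ltr 0) (m + 1), wpow (ltr 0) (m + 2)), commId}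

/-- `D m = var{xᵐ = 0, xy = yx}`. -/
def Dvar (m : ℕ) : ComVariety := comVar ({commId} ∪ zeroId (wpow (ltr 0) m) 1)

/-- The word `x₁x₂⋯x_k` (in the letters `0, 1, …, k-1`), for `k ≥ 1`. -/
def chainWord : ℕ → SGWord
  | 0 => ltr 0
  | 1 => ltr 0
  | k + 2 => chainWord (k + 1) * ltr (k + 1)

/-- `N k = var{x² = x₁x₂⋯x_k = 0, xy = yx}`. -/
def Nvar (k : ℕ) : ComVariety :=
  comVar ({commId} ∪ zeroId (wpow (ltr 0) 2) 1 ∪ zeroId (chainWord k) k)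

/-- `N_ω = var{x² = 0, xy = yx}`. -/
def Nomegavar : ComVariety := comVar ({commId} ∪ zeroId (wpow (ltr 0) 2) 1)

/-- `N₃ᶜ = var{xyz = 0, xy = yx}`. -/
def N3cvar : ComVariety := comVar ({commId} ∪ zeroId (ltr 0 * ltr 1 * ltr 2) 3)

/-! ### Semantic notions -/

/-- A semigroup `S` belongs to the variety `V` if it satisfies every identity of `V`. -/
def VMem (S : Type) [Semigroup S] (V : ComVariety) : Prop :=
  ∀ i ∈ V.theory, SGSatisfies S i

/-- `spow a n` is the power `aⁿ` in a semigroup (for `n ≥ 1`; by convention `spow a 0 = a`). -/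
def spow {S : Type} [Semigroup S] (a : S) : ℕ → S
  | 0 => a
  | 1 => a
  | n + 2 => spow a (n + 1) * a

/-- A semigroup is a group. -/
def IsGroupSG (S : Type) [Semigroup S] : Prop :=
  ∃ e : S, (∀ a, e * a = a ∧ a * e = a) ∧ ∀ a, ∃ b, a * b = e ∧ b * a = e

/-- A semigroup is periodic: every element generates a finite cyclic subsemigroup. -/
def IsPeriodicSG (S : Type) [Semigroup S] : Prop :=
  ∀ a : S, ∃ i j : ℕ, 1 ≤ i ∧ i < j ∧ spow a i = spow a j

/-- A semigroup is a nil-semigroup: it has a zero element and every element has a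
power equal to zero. -/
def IsNilSG (S : Type) [Semigroup S] : Prop :=
  ∃ z : S, (∀ a, z * a = z ∧ a * z = z) ∧ ∀ a, ∃ n, 1 ≤ n ∧ spow a n = z

/-- A variety all of whose members are groups. -/
def IsGroupVariety (V : ComVariety) : Prop := ∀ S ∈ modelsOf V.theory, IsGroupSG S.carrier

/-- A variety all of whose members are periodic semigroups. -/
def IsPeriodicVariety (V : ComVariety) : Prop := ∀ S ∈ modelsOf V.theory, IsPeriodicSG S.carrier

/-- A nil-variety: a variety all of whose members are nil-semigroups. -/
def IsNilVariety (V : ComVariety) : Prop := ∀ S ∈ modelsOf V.theory, IsNilSG S.carrier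

/-- A combinatorial variety: all groups in it are trivial. -/
def IsCombinatorial (V : ComVariety) : Prop :=
  ∀ S ∈ modelsOf V.theory, IsGroupSG S.carrier → ∀ a b : S.carrier, a = b

/-- `K` is the variety generated by the semigroup `M` (with explicit semigroup
structure `inst`): the smallest variety containing `M`. -/
def GeneratedBy (M : Type) (inst : Semigroup M) (K : ComVariety) : Prop :=
  IsLeast {W : ComVariety | ∀ i ∈ W.theory, @SGSatisfies M inst i} K

/-- A neutral element of a lattice. -/
def IsNeutralElt {α : Type*} [Lattice α] (x : α) : Prop :=
  ∀ y z, (x ⊔ y) ⊓ (y ⊔ z) ⊓ (z ⊔ x) = (x ⊓ y) ⊔ (y ⊓ z) ⊔ (z ⊓ x)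

/-- A chain variety: a variety whose lattice of subvarieties is a chain. -/
def IsChainVariety (V : ComVariety) : Prop :=
  ∀ W₁ W₂ : ComVariety, W₁ ≤ V → W₂ ≤ V → W₁ ≤ W₂ ∨ W₂ ≤ W₁

/-- A variety is 0-reduced in **Com** if it is given within `COM` by 0-reduced
identities (identities of the form `w = 0`) only. -/
def IsZeroReduced (V : ComVariety) : Prop :=
  ∃ P : Set (SGWord × ℕ), (∀ p ∈ P, ¬ OccursIn p.2 p.1) ∧
    V = comVar (⋃ p ∈ P, zeroId p.1 p.2)

/-- `ZR V`: the least variety 0-reduced in **Com** that contains `V`. -/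
def ZRv (V : ComVariety) : ComVariety := sInf {W : ComVariety | IsZeroReduced W ∧ V ≤ W}

/-! ### Evaluation of words -/

/-- The multiset of letters of a word. -/
def letters (w : SGWord) : Multiset ℕ := w.head ::ₘ (w.tail : Multiset ℕ)

theorem letters_ltr (n : ℕ) : letters (ltr n) = {n} := rfl

theorem letters_mul (u v : SGWord) : letters (u * v) = letters u + letters v := by
  simp [letters, ← Multiset.coe_add, ← Multiset.cons_coe, Multiset.cons_swap u.head]

theorem letters_ne_zero (w : SGWord) : letters w ≠ 0 := Multiset.cons_ne_zero

theorem lift_eq_prod {M : Type*} [CommMonoid M] (f : ℕ → M) (w : SGWord) :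
    FreeSemigroup.lift f w = ((letters w).map f).prod := by
  induction w using FreeSemigroup.recOnMul with
  | ih1 n => simp [show letters (FreeSemigroup.of n) = {n} from rfl]
  | ih2 x y hx hy =>
    rw [map_mul, hy, hx, show letters (FreeSemigroup.of x * y) = _ from letters_mul (ltr x) y]
    simp [show letters (FreeSemigroup.of x) = {x} from rfl, letters_ltr]

theorem coe_lift {S : Type*} [CommSemigroup S] (f : ℕ → S) (w : SGWord) :
    ((FreeSemigroup.lift f w : S) : WithOne S) =
      ((letters w).map fun i => (f i : WithOne S)).prod := by
  rw [← lift_eq_prod]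
  induction w using FreeSemigroup.recOnMul with
  | ih1 n => simp
  | ih2 x y hx hy => rw [map_mul, map_mul, WithOne.coe_mul, hx, hy]

theorem letters_wpow (w : SGWord) : ∀ {n : ℕ}, n ≠ 0 → letters (wpow w n) = n • letters w
  | 1, _ => by simp [wpow]
  | n + 2, _ => by
    rw [wpow, letters_mul, letters_wpow w n.succ_ne_zero, succ_nsmul (letters w) (n + 1)]

theorem sgSatisfies_iff {S : Type} [CommSemigroup S] (i : SGId) :
    SGSatisfies S i ↔ ∀ f : ℕ → S, ((letters i.1).map fun j => (f j : WithOne S)).prod =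
      ((letters i.2).map fun j => (f j : WithOne S)).prod := by
  simp only [SGSatisfies, ← coe_lift, WithOne.coe_inj]

/-- Evaluation of a multiset of letters under which one letter plays a distinguished role. -/
theorem prod_map_ite_eq {M : Type*} [CommMonoid M] (m : Multiset ℕ) (i : ℕ) (a b : M) :
    ∃ k, k + m.count i = m.card ∧
      (m.map fun j => if j = i then b else a).prod = a ^ k * b ^ m.count i := by
  induction m using Multiset.induction_on with
  | empty => exact ⟨0, by simp⟩
  | cons j m ih =>
    obtain ⟨k, hk, h⟩ := ih
    by_cases hj : j = i
    · subst hj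
      refine ⟨k, by simp; omega, ?_⟩
      simp only [Multiset.map_cons, Multiset.prod_cons, h, if_true, Multiset.count_cons_self,
        pow_succ]
      ac_rfl
    · refine ⟨k + 1, by simp [Multiset.count_cons_of_ne (Ne.symm hj)]; omega, ?_⟩
      simp only [Multiset.map_cons, Multiset.prod_cons, h, hj, if_false,
        Multiset.count_cons_of_ne (Ne.symm hj), pow_succ]
      ac_rfl

theorem prod_map_ite_one {M : Type*} [CommMonoid M] (m : Multiset ℕ) (i : ℕ) (b : M) :
    (m.map fun j => if j = i then b else 1).prod = b ^ m.count i := by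
  obtain ⟨k, -, h⟩ := prod_map_ite_eq m i 1 b
  simpa using h

/-! ### Varieties and their models -/

theorem modelsOf_comVar (E : Set SGId) : modelsOf (comVar E).theory = modelsOf E :=
  subset_antisymm (modelsOf_antitone (subset_theoryOfClass_modelsOf E))
    fun S hS _ hi => hi S hS

theorem mem_theory_iff {V : ComVariety} {i : SGId} :
    i ∈ V.theory ↔ ∀ S ∈ modelsOf V.theory, SGSatisfies S.carrier i := by
  conv_lhs => rw [← V.closed]
  rfl

theorem le_iff_models {V W : ComVariety} :
    V ≤ W ↔ ∀ S ∈ modelsOf V.theory, S ∈ modelsOf W.theory :=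
  ⟨fun h _ hS => modelsOf_antitone h hS,
    fun h _ hi => mem_theory_iff.2 fun S hS => h S hS _ hi⟩

theorem sgSatisfies_commId (S : ComSG) : SGSatisfies S.carrier commId := by
  intro f
  simp [commId, mul_comm]

theorem ne_bot_iff {V : ComVariety} :
    V ≠ ⊥ ↔ ∃ S ∈ modelsOf V.theory, ∃ a b : S.carrier, a ≠ b := by
  constructor
  · intro h
    by_contra! h'
    refine h (le_bot_iff.1 (le_iff_models.2 fun S hS i _ f => h' S hS _ _))
  · rintro ⟨S, hS, a, b, hab⟩ rfl
    have h : S ∈ modelsOf Tvar.theory := le_iff_models.1 bot_le S hS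
    rw [Tvar, modelsOf_comVar] at h
    have := h _ rfl (fun n => if n = 0 then a else b)
    simp [ltr, hab] at this

theorem mem_models_Avar {n : ℕ} (hn : n ≠ 0) {S : ComSG} :
    S ∈ modelsOf (Avar n).theory ↔
      ∀ a b : S.carrier, (a : WithOne S.carrier) ^ n * b = b := by
  rw [Avar, modelsOf_comVar]
  simp only [modelsOf, Set.mem_ofPred_eq, Set.mem_insert_iff, Set.mem_singleton_iff, forall_eq_or_imp,
    forall_eq, sgSatisfies_commId, and_true]
  rw [sgSatisfies_iff]
  simp only [letters_mul, letters_wpow _ hn, letters_ltr, Multiset.map_add, Multiset.map_nsmul,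
    Multiset.map_singleton, Multiset.prod_add, Multiset.prod_nsmul, Multiset.prod_singleton]
  exact ⟨fun h a b => h (fun j => if j = 0 then a else b), fun h f => h _ _⟩

theorem mem_models_SLvar {S : ComSG} :
    S ∈ modelsOf SLvar.theory ↔ ∀ a : S.carrier, a * a = a := by
  rw [SLvar, modelsOf_comVar]
  simp only [modelsOf, Set.mem_ofPred_eq, Set.mem_insert_iff, Set.mem_singleton_iff, forall_eq_or_imp,
    forall_eq, sgSatisfies_commId, and_true]
  simp only [SGSatisfies, wpow, map_mul, ltr, FreeSemigroup.lift_of]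
  exact ⟨fun h a => h fun _ => a, fun h f => h _⟩

theorem mem_models_ZMvar {S : ComSG} :
    S ∈ modelsOf ZMvar.theory ↔ ∀ a b c : S.carrier, a * b * c = a * b := by
  rw [ZMvar, modelsOf_comVar]
  simp only [modelsOf, zeroId, Set.mem_ofPred_eq, Set.singleton_union, Set.mem_insert_iff,
    Set.mem_singleton_iff, forall_eq_or_imp, forall_eq, sgSatisfies_commId, true_and]
  simp only [SGSatisfies, map_mul, ltr, FreeSemigroup.lift_of]
  refine ⟨fun h a b c => h.1 fun j => if j = 0 then a else if j = 1 then b else c,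
    fun h => ⟨fun f => h _ _ _, fun f => ?_⟩⟩
  rw [mul_comm]
  exact h _ _ _

theorem mem_models_Nomegavar {S : ComSG} :
    S ∈ modelsOf Nomegavar.theory ↔ ∀ a b : S.carrier, a * a * b = a * a := by
  rw [Nomegavar, modelsOf_comVar]
  simp only [modelsOf, zeroId, Set.mem_ofPred_eq, Set.singleton_union, Set.mem_insert_iff,
    Set.mem_singleton_iff, forall_eq_or_imp, forall_eq, sgSatisfies_commId, true_and]
  simp only [SGSatisfies, wpow, map_mul, ltr, FreeSemigroup.lift_of]
  refine ⟨fun h a b => h.1 fun j => if j = 0 then a else b,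
    fun h => ⟨fun f => h _ _, fun f => ?_⟩⟩
  rw [mul_comm]
  exact h _ _

theorem mem_models_N3cvar {S : ComSG} :
    S ∈ modelsOf N3cvar.theory ↔ ∀ a b c d : S.carrier, a * b * c * d = a * b * c := by
  rw [N3cvar, modelsOf_comVar]
  simp only [modelsOf, zeroId, Set.mem_ofPred_eq, Set.singleton_union, Set.mem_insert_iff,
    Set.mem_singleton_iff, forall_eq_or_imp, forall_eq, sgSatisfies_commId, true_and]
  simp only [SGSatisfies, map_mul, ltr, FreeSemigroup.lift_of]
  refine ⟨fun h a b c d => h.1 fun j => if j = 0 then a else if j = 1 then b else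
    if j = 2 then c else d, fun h => ⟨fun f => h _ _ _ _, fun f => ?_⟩⟩
  rw [mul_comm]
  exact h _ _ _ _

theorem SGSatisfies.symm {S : Type} [Semigroup S] {u v : SGWord} (h : SGSatisfies S (u, v)) :
    SGSatisfies S (v, u) := fun f => (h f).symm

theorem IsCombinatorial.anti {V W : ComVariety} (hW : IsCombinatorial W) (h : V ≤ W) :
    IsCombinatorial V := fun S hS => hW S (le_iff_models.1 h S hS)

/-! ### Groups in varieties -/

/-- The commutative group structure on a commutative semigroup that is a group. -/
@[reducible] noncomputable def IsGroupSG.commGroup {S : Type} [str : CommSemigroup S]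
    (h : IsGroupSG S) : CommGroup S :=
  { str with
    one := h.choose
    one_mul := fun a => (h.choose_spec.1 a).1
    mul_one := fun a => (h.choose_spec.1 a).2
    inv := fun a => (h.choose_spec.2 a).choose
    inv_mul_cancel := fun a => (h.choose_spec.2 a).choose_spec.2 }

theorem isGroupSG_of_group (G : Type) [Group G] : IsGroupSG G :=
  ⟨1, fun a => ⟨one_mul a, mul_one a⟩, fun a => ⟨a⁻¹, mul_inv_cancel a, inv_mul_cancel a⟩⟩

theorem coe_pow_mul_coe {M : Type*} [Monoid M] (a b : M) (n : ℕ) :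
    (a : WithOne M) ^ n * b = ((a ^ n * b : M) : WithOne M) := by
  induction n with
  | zero => simp
  | succ n ih => rw [pow_succ', mul_assoc, ih, ← WithOne.coe_mul, ← mul_assoc, ← pow_succ']

theorem exists_coe_eq_pow {S : Type*} [Semigroup S] (a : S) :
    ∀ {n : ℕ}, n ≠ 0 → ∃ c : S, (c : WithOne S) = (a : WithOne S) ^ n
  | 1, _ => ⟨a, by simp⟩
  | n + 2, _ => by
    obtain ⟨c, hc⟩ := exists_coe_eq_pow a n.succ_ne_zero
    exact ⟨c * a, by rw [WithOne.coe_mul, hc, ← pow_succ]⟩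

theorem isGroupSG_of_pow {S : Type} [CommSemigroup S] [Nonempty S] {n : ℕ} (hn : n ≠ 0)
    (h : ∀ a b : S, (a : WithOne S) ^ n * b = b) : IsGroupSG S := by
  obtain ⟨a₀⟩ := ‹Nonempty S›
  obtain ⟨e, he⟩ := exists_coe_eq_pow a₀ hn
  have he' : ∀ a : S, e * a = a := fun a => by
    rw [← WithOne.coe_inj, WithOne.coe_mul, he, h]
  refine ⟨e, fun a => ⟨he' a, by rw [mul_comm, he']⟩, fun a => ?_⟩
  obtain ⟨c, hc⟩ := exists_coe_eq_pow a (n := 2 * n - 1) (by omega)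
  have hac : a * c = e := by
    rw [← WithOne.coe_inj, WithOne.coe_mul, hc, ← pow_succ',
      show 2 * n - 1 + 1 = n + n by omega, pow_add]
    obtain ⟨d, hd⟩ := exists_coe_eq_pow a hn
    calc (a : WithOne S) ^ n * a ^ n = (a : WithOne S) ^ n * e := by
          rw [← hd]
          nth_rw 2 [← he' d]
          rw [mul_comm e d, WithOne.coe_mul, hd, ← mul_assoc, ← pow_add, pow_add, mul_assoc, h, h]
      _ = e := h _ _
  exact ⟨c, hac, by rw [mul_comm, hac]⟩

theorem mem_models_Avar_iff_group {n : ℕ} (hn : n ≠ 0) {S : ComSG} :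
    S ∈ modelsOf (Avar n).theory ↔
      ∃ h : IsGroupSG S.carrier, ∀ a : S.carrier, h.commGroup.npow n a = h.commGroup.one := by
  rw [mem_models_Avar hn]
  have key : ∀ h : IsGroupSG S.carrier, (∀ a b : S.carrier, (a : WithOne S.carrier) ^ n * b = b) ↔
      ∀ a : S.carrier, h.commGroup.npow n a = h.commGroup.one := by
    intro h
    let _ := h.commGroup
    change (∀ a b : S.carrier, (a : WithOne S.carrier) ^ n * b = b) ↔ ∀ a : S.carrier, a ^ n = 1
    refine ⟨fun H a => ?_, fun H a b => ?_⟩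
    · have := H a 1
      erw [coe_pow_mul_coe, WithOne.coe_inj] at this
      simpa using this
    · erw [coe_pow_mul_coe, WithOne.coe_inj]
      rw [H, one_mul]
  exact ⟨fun H => ⟨isGroupSG_of_pow hn H, (key _).1 H⟩, fun ⟨h, H⟩ => (key h).2 H⟩

theorem prod_map_eq_of_modEq {G : Type*} [CommGroup G] {n : ℕ} (h : ∀ a : G, a ^ n = 1)
    {u v : Multiset ℕ} (huv : ∀ j, u.count j ≡ v.count j [MOD n]) (f : ℕ → G) :
    (u.map f).prod = (v.map f).prod := by
  have aux : ∀ w s : Multiset ℕ, w ≤ s →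
      (w.map f).prod = ∏ j ∈ s.toFinset, f j ^ w.count j := fun w s hws => by
    rw [Finset.prod_multiset_map_count]
    refine Finset.prod_subset (Multiset.toFinset_subset.2 (Multiset.subset_of_le hws)) ?_
    intro j _ hj
    rw [Multiset.count_eq_zero_of_notMem (by simpa using hj), pow_zero]
  rw [aux u (u + v) (Multiset.le_add_right _ _), aux v (u + v) (Multiset.le_add_left _ _)]
  refine Finset.prod_congr rfl fun j _ => ?_
  exact pow_eq_pow_iff_modEq.2 ((huv j).of_dvd (orderOf_dvd_of_pow_eq_one (h _)))

/-- The cyclic group of order `n`, as a commutative semigroup. -/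
def cyclicSG (n : ℕ) : ComSG := ⟨Multiplicative (ZMod n)⟩

theorem cyclicSG_mem {n : ℕ} (hn : n ≠ 0) : cyclicSG n ∈ modelsOf (Avar n).theory := by
  rw [mem_models_Avar hn]
  intro (a : Multiplicative (ZMod n)) (b : Multiplicative (ZMod n))
  have h : ∀ c : Multiplicative (ZMod n), c ^ n = 1 := fun c =>
    Multiplicative.toAdd.injective (by simp)
  exact (coe_pow_mul_coe a b n).trans (by rw [h, one_mul]; rfl)

theorem modEq_of_cyclicSG {n : ℕ} {i : SGId} (h : SGSatisfies (cyclicSG n).carrier i) (j : ℕ) :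
    (letters i.1).count j ≡ (letters i.2).count j [MOD n] := by
  have := h fun k => if k = j then (Multiplicative.ofAdd (1 : ZMod n)) else
    (1 : Multiplicative (ZMod n))
  have h2 : ∀ w : SGWord, FreeSemigroup.lift (fun k => if k = j then
      (Multiplicative.ofAdd (1 : ZMod n)) else 1) w =
      Multiplicative.ofAdd (1 : ZMod n) ^ (letters w).count j := fun w => by
    rw [lift_eq_prod, prod_map_ite_one]
  erw [h2, h2] at this
  have := congrArg Multiplicative.toAdd this
  simpa [ZMod.natCast_eq_natCast_iff] using this

theorem mem_theory_Avar {n : ℕ} (hn : n ≠ 0) {i : SGId} : i ∈ (Avar n).theory ↔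
    ∀ j, (letters i.1).count j ≡ (letters i.2).count j [MOD n] := by
  refine ⟨fun h => modEq_of_cyclicSG (mem_theory_iff.1 h _ (cyclicSG_mem hn)), fun H => ?_⟩
  refine mem_theory_iff.2 fun S hS f => ?_
  obtain ⟨h, hp⟩ := (mem_models_Avar_iff_group hn).1 hS
  let _ := h.commGroup
  have := prod_map_eq_of_modEq hp H f
  rwa [← lift_eq_prod, ← lift_eq_prod] at this

theorem Avar_le_Avar {m n : ℕ} (hm : m ≠ 0) (hn : n ≠ 0) : Avar m ≤ Avar n ↔ m ∣ n := by
  constructor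
  · intro h
    have h1 : (wpow (ltr 0) n * ltr 1, ltr 1) ∈ (Avar n).theory :=
      subset_theoryOfClass_modelsOf _ (Or.inl rfl)
    have h2 := (mem_theory_Avar hm).1 (h h1) 0
    simp only [letters_mul, letters_wpow _ hn, letters_ltr] at h2
    simpa [Nat.modEq_zero_iff_dvd] using h2
  · intro h i hi
    rw [mem_theory_Avar hm]
    exact fun j => ((mem_theory_Avar hn).1 hi j).of_dvd h

theorem Avar_not_isCombinatorial {n : ℕ} (hn : 1 < n) : ¬ IsCombinatorial (Avar n) := by
  intro h
  have : Fact (1 < n) := ⟨hn⟩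
  have h01 := h _ (cyclicSG_mem (by omega)) (isGroupSG_of_group (Multiplicative (ZMod n)))
    (Multiplicative.ofAdd (0 : ZMod n)) (Multiplicative.ofAdd (1 : ZMod n))
  exact zero_ne_one (α := ZMod n) (Multiplicative.ofAdd.injective h01)

theorem isCombinatorial_iff (V : ComVariety) :
    IsCombinatorial V ↔ ∀ p : ℕ, p.Prime → ¬ Avar p ≤ V := by
  refine ⟨fun h p hp hle => Avar_not_isCombinatorial hp.one_lt (h.anti hle), fun H S hS hG => ?_⟩
  let _ := hG.commGroup
  by_contra! hne
  obtain ⟨a, ha⟩ : ∃ a : S.carrier, a ≠ 1 := by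
    by_contra! h1
    obtain ⟨a, b, hab⟩ := hne
    exact hab ((h1 a).trans (h1 b).symm)
  obtain ⟨p, hp, hpa⟩ := Nat.exists_prime_and_dvd (mt orderOf_eq_one_iff.1 ha)
  refine H p hp fun i hi => (mem_theory_Avar hp.ne_zero).2 fun j => ?_
  have h1 := mem_theory_iff.1 hi S hS fun k => if k = j then a else 1
  erw [lift_eq_prod, lift_eq_prod, prod_map_ite_one, prod_map_ite_one] at h1
  exact (pow_eq_pow_iff_modEq.1 h1).of_dvd hpa

theorem exists_eq_Avar {V : ComVariety} {n : ℕ} (hn : n ≠ 0) (h : V ≤ Avar n) :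
    ∃ d, d ≠ 0 ∧ V = Avar d := by
  classical
  have hex : ∃ d, d ≠ 0 ∧ V ≤ Avar d := ⟨n, hn, h⟩
  obtain ⟨hd, hV⟩ := Nat.find_spec hex
  have hmin : ∀ m, m ≠ 0 → V ≤ Avar m → Nat.find hex ≤ m := fun m h1 h2 => Nat.find_min' hex ⟨h1, h2⟩
  generalize Nat.find hex = d at hd hV hmin
  refine ⟨d, hd, le_antisymm hV fun i hi => (mem_theory_Avar hd).2 fun j => ?_⟩
  set x := (letters i.1).count j
  set y := (letters i.2).count j
  have hg : Nat.gcd d (((y : ℤ) - x).natAbs) ≠ 0 := Nat.gcd_ne_zero_left hd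
  have hVg : V ≤ Avar (Nat.gcd d (((y : ℤ) - x).natAbs)) := by
    refine le_iff_models.2 fun S hS => (mem_models_Avar_iff_group hg).2 ?_
    obtain ⟨hG, hp⟩ := (mem_models_Avar_iff_group hd).1 (le_iff_models.1 hV S hS)
    refine ⟨hG, fun a => ?_⟩
    let _ := hG.commGroup
    have h1 := mem_theory_iff.1 hi S hS fun k => if k = j then a else 1
    erw [lift_eq_prod, lift_eq_prod, prod_map_ite_one, prod_map_ite_one] at h1
    have h2 := Int.natCast_dvd.1 (Nat.modEq_iff_dvd.1 (pow_eq_pow_iff_modEq.1 h1))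
    exact orderOf_dvd_iff_pow_eq_one.1
      (Nat.dvd_gcd (orderOf_dvd_of_pow_eq_one (hp a)) h2)
  have heq : Nat.gcd d (((y : ℤ) - x).natAbs) = d :=
    le_antisymm (Nat.gcd_le_left _ (Nat.pos_of_ne_zero hd)) (hmin _ hg hVg)
  exact Nat.modEq_iff_dvd.2 (Int.natCast_dvd.2 (Nat.gcd_eq_left_iff_dvd.1 heq))

theorem Avar_one : Avar 1 = ⊥ := by
  by_contra h
  obtain ⟨S, hS, a, b, hab⟩ := ne_bot_iff.1 h
  obtain ⟨hG, hp⟩ := (mem_models_Avar_iff_group one_ne_zero).1 hS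
  let _ := hG.commGroup
  have hp' : ∀ c : S.carrier, c ^ 1 = 1 := hp
  simp only [pow_one] at hp'
  exact hab ((hp' a).trans (hp' b).symm)

theorem Avar_ne_bot {n : ℕ} (hn : 1 < n) : Avar n ≠ ⊥ := by
  rw [← Avar_one]
  intro h
  have := (Avar_le_Avar (by omega) one_ne_zero).1 h.le
  exact hn.ne' (Nat.dvd_one.1 this)

/-! ### Varieties omitting an atom -/

theorem SGWord.eq_ltr_or_eq_mul (w : SGWord) : (∃ n, w = ltr n) ∨ ∃ u v : SGWord, w = u * v := by
  induction w using FreeSemigroup.recOnMul with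
  | ih1 n => exact Or.inl ⟨n, rfl⟩
  | ih2 x y _ _ => exact Or.inr ⟨_, y, rfl⟩

theorem two_le_card_letters_mul (u v : SGWord) : 2 ≤ (letters (u * v)).card := by
  have hu := Multiset.card_pos.2 (letters_ne_zero u)
  have hv := Multiset.card_pos.2 (letters_ne_zero v)
  rw [letters_mul, Multiset.card_add]
  omega

theorem exists_pow_of_ltr_mem {V : ComVariety} {m : ℕ} {v : SGWord} (h : (ltr m, v) ∈ V.theory)
    (hZ : (ltr m, v) ∉ ZMvar.theory) :
    ∃ n ≠ 0, ∀ S ∈ modelsOf V.theory, ∀ a : S.carrier, (a : WithOne S.carrier) ^ (n + 1) = a := by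
  rcases v.eq_ltr_or_eq_mul with ⟨k, rfl⟩ | ⟨x, y, rfl⟩
  · have hk : k ≠ m := by
      rintro rfl
      exact hZ (mem_theory_iff.2 fun S _ f => rfl)
    refine ⟨1, one_ne_zero, fun S hS a => ?_⟩
    have := mem_theory_iff.1 h S hS fun j => if j = k then a else a * a
    simp only [ltr, FreeSemigroup.lift_of, hk.symm, if_false, if_true] at this
    rw [one_add_one_eq_two, pow_two, ← WithOne.coe_mul, this]
  · have h2 := two_le_card_letters_mul x y
    refine ⟨(letters (x * y)).card - 1, by omega, fun S hS a => ?_⟩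
    have := (sgSatisfies_iff _).1 (mem_theory_iff.1 h S hS) fun _ => a
    simp only [letters_ltr, Multiset.map_const', Multiset.prod_replicate, Multiset.card_singleton,
      pow_one] at this
    rw [Nat.sub_add_cancel (by omega)]
    exact this.symm

theorem exists_pow_of_not_ZMvar_le {V : ComVariety} (h : ¬ ZMvar ≤ V) :
    ∃ n ≠ 0, ∀ S ∈ modelsOf V.theory, ∀ a : S.carrier, (a : WithOne S.carrier) ^ (n + 1) = a := by
  obtain ⟨⟨u, v⟩, hi, hZ⟩ := Set.not_subset.1 h
  have hi' : (v, u) ∈ V.theory := mem_theory_iff.2 fun S hS => (mem_theory_iff.1 hi S hS).symm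
  have hZ' : (v, u) ∉ ZMvar.theory := fun h' =>
    hZ (mem_theory_iff.2 fun S hS => (mem_theory_iff.1 h' S hS).symm)
  rcases u.eq_ltr_or_eq_mul with ⟨m, rfl⟩ | ⟨x, y, rfl⟩
  · exact exists_pow_of_ltr_mem hi hZ
  rcases v.eq_ltr_or_eq_mul with ⟨m, rfl⟩ | ⟨z, t, rfl⟩
  · exact exists_pow_of_ltr_mem hi' hZ'
  refine absurd (mem_theory_iff.2 fun S hS f => ?_) hZ
  have H := mem_models_ZMvar.1 hS
  have H' : ∀ a b c d : S.carrier, a * b = c * d := fun a b c d => by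
    rw [← H a b (c * d), mul_comm, ← mul_assoc, H (c * d) a b, H]
  simp only [map_mul]
  exact H' _ _ _ _

theorem pow_eq_of_content_ne {V : ComVariety} {n : ℕ} (hn : n ≠ 0)
    (hV : ∀ S ∈ modelsOf V.theory, ∀ a : S.carrier, (a : WithOne S.carrier) ^ (n + 1) = a)
    {u v : SGWord} (h : (u, v) ∈ V.theory) {j : ℕ} (hu : j ∈ letters u) (hv : j ∉ letters v) :
    V ≤ Avar n := by
  refine le_iff_models.2 fun S hS => (mem_models_Avar hn).2 ?_
  have hidem : ∀ a : S.carrier, IsIdempotentElem ((a : WithOne S.carrier) ^ n) := fun a => by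
    obtain ⟨k, rfl⟩ := Nat.exists_eq_succ_of_ne_zero hn
    change (a : WithOne S.carrier) ^ (k + 1) * a ^ (k + 1) = a ^ (k + 1)
    rw [← pow_add, show k + 1 + (k + 1) = k + 1 + 1 + k by omega, pow_add, hV S hS, pow_succ']
  have key : ∀ a b : S.carrier, (a : WithOne S.carrier) ^ n * b ^ n = a ^ n := fun a b => by
    have h1 := (sgSatisfies_iff _).1 (mem_theory_iff.1 h S hS) fun i => if i = j then b else a
    have h2 : ∀ i, (((if i = j then b else a : S.carrier)) : WithOne S.carrier) =
      if i = j then (b : WithOne S.carrier) else a := fun i => by split <;> rfl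
    simp only [h2] at h1
    obtain ⟨k, -, hk⟩ := prod_map_ite_eq (letters u) j (a : WithOne S.carrier) b
    obtain ⟨m, hm, hm'⟩ := prod_map_ite_eq (letters v) j (a : WithOne S.carrier) b
    have hvc := Multiset.count_eq_zero.2 hv
    have huc := Multiset.count_ne_zero.2 hu
    have hm0 : m ≠ 0 := by
      have := Multiset.card_pos.2 (letters_ne_zero v)
      omega
    rw [hk, hm', hvc, pow_zero, mul_one] at h1
    have h3 := congrArg (· ^ n) h1
    simp only [mul_pow, ← pow_mul, mul_comm _ n] at h3
    simp only [pow_mul] at h3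
    have hp : ∀ (c : S.carrier) (l : ℕ), l ≠ 0 →
        ((c : WithOne S.carrier) ^ n) ^ l = (c : WithOne S.carrier) ^ n := fun c l hl => by
      obtain ⟨l, rfl⟩ := Nat.exists_eq_succ_of_ne_zero hl
      exact (hidem c).pow_succ_eq l
    rw [hp b _ huc, hp a m hm0] at h3
    have h4 := congrArg ((a : WithOne S.carrier) ^ n * ·) h3
    simp only [← mul_assoc] at h4
    rwa [← pow_succ', hp a _ k.succ_ne_zero, (hidem a).eq] at h4
  intro a b
  have hab : (a : WithOne S.carrier) ^ n = b ^ n := by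
    rw [← key a b, mul_comm, key b a]
  rw [hab, ← pow_succ, hV S hS]

theorem le_Avar_of_not_SLvar_le {V : ComVariety} {n : ℕ} (hn : n ≠ 0)
    (hV : ∀ S ∈ modelsOf V.theory, ∀ a : S.carrier, (a : WithOne S.carrier) ^ (n + 1) = a)
    (h : ¬ SLvar ≤ V) : V ≤ Avar n := by
  obtain ⟨⟨u, v⟩, hi, hS⟩ := Set.not_subset.1 h
  have hi' : (v, u) ∈ V.theory := mem_theory_iff.2 fun S hS => (mem_theory_iff.1 hi S hS).symm
  by_contra hle
  refine hS (mem_theory_iff.2 fun S hS => (sgSatisfies_iff _).2 fun f => ?_)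
  have hcontent : (letters u).toFinset = (letters v).toFinset := by
    ext j
    rw [Multiset.mem_toFinset, Multiset.mem_toFinset]
    by_contra hj
    rcases not_iff.1 hj with hj
    by_cases hju : j ∈ letters u
    · exact hle (pow_eq_of_content_ne hn hV hi hju fun hjv => hj.2 hjv hju)
    · exact hle (pow_eq_of_content_ne hn hV hi' (hj.1 hju) hju)
  have hprod : ∀ w : SGWord, ((letters w).map fun j => (f j : WithOne S.carrier)).prod =
      ∏ j ∈ (letters w).toFinset, (f j : WithOne S.carrier) := fun w => by
    rw [Finset.prod_multiset_map_count]
    refine Finset.prod_congr rfl fun j hj => ?_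
    have hidem : IsIdempotentElem (f j : WithOne S.carrier) := by
      change (f j : WithOne S.carrier) * f j = f j
      rw [← WithOne.coe_mul, mem_models_SLvar.1 hS]
    obtain ⟨l, hl⟩ := Nat.exists_eq_succ_of_ne_zero
      (Multiset.count_ne_zero.2 (Multiset.mem_toFinset.1 hj))
    rw [hl]
    exact hidem.pow_succ_eq l
  rw [hprod, hprod, hcontent]

theorem exists_eq_Avar_of_not_le {V : ComVariety} (hZ : ¬ ZMvar ≤ V) (hS : ¬ SLvar ≤ V) :
    ∃ d, d ≠ 0 ∧ V = Avar d := by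
  obtain ⟨n, hn, hV⟩ := exists_pow_of_not_ZMvar_le hZ
  exact exists_eq_Avar hn (le_Avar_of_not_SLvar_le hn hV hS)

theorem IsCombinatorial.le_SLvar {V : ComVariety} (hV : IsCombinatorial V) (hZ : ¬ ZMvar ≤ V) :
    V ≤ SLvar := by
  obtain ⟨n, hn, hp⟩ := exists_pow_of_not_ZMvar_le hZ
  refine le_iff_models.2 fun S hS => mem_models_SLvar.2 fun a => ?_
  obtain ⟨e, he⟩ := exists_coe_eq_pow a hn
  have hidem : IsIdempotentElem ((a : WithOne S.carrier) ^ n) := by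
    obtain ⟨k, rfl⟩ := Nat.exists_eq_succ_of_ne_zero hn
    change (a : WithOne S.carrier) ^ (k + 1) * a ^ (k + 1) = a ^ (k + 1)
    rw [← pow_add, show k + 1 + (k + 1) = k + 1 + 1 + k by omega, pow_add, hp S hS, pow_succ']
  let H : Subsemigroup S.carrier :=
    { carrier := {x | (x : WithOne S.carrier) ^ n = a ^ n}
      mul_mem' := fun {x y} hx hy => by
        change ((x * y : S.carrier) : WithOne S.carrier) ^ n = a ^ n
        rw [WithOne.coe_mul, mul_pow, hx, hy, hidem.eq] }
  have haH : a ∈ H := rfl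
  have heH : e ∈ H := by
    change (e : WithOne S.carrier) ^ n = a ^ n
    obtain ⟨k, rfl⟩ := Nat.exists_eq_succ_of_ne_zero hn
    rw [he]
    exact hidem.pow_succ_eq k
  have heq : ∀ x ∈ H, e * x = x := fun x hx => by
    have hx' : (x : WithOne S.carrier) ^ n = a ^ n := hx
    rw [← WithOne.coe_inj, WithOne.coe_mul, he, ← hx', ← pow_succ, hp S hS]
  let T : ComSG := @ComSG.mk H inferInstance ⟨⟨a, haH⟩⟩
  have hT : T ∈ modelsOf V.theory := fun i hi f => by
    apply Subtype.val_injective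
    have h1 : ∀ w : SGWord, ((FreeSemigroup.lift f w : H) : S.carrier) =
        FreeSemigroup.lift (fun j => ((f j : H) : S.carrier)) w := fun w => by
      induction w using FreeSemigroup.recOnMul with
      | ih1 n => rfl
      | ih2 x y hx hy =>
        rw [map_mul, map_mul, ← hx, ← hy]
        rfl
    exact (h1 _).trans ((mem_theory_iff.1 hi S hS _).trans (h1 _).symm)
  have hG : IsGroupSG T.carrier := by
    refine ⟨⟨e, heH⟩, fun x => ⟨Subtype.ext (heq _ x.2), ?_⟩, fun x => ?_⟩
    · rw [mul_comm]
      exact Subtype.ext (heq _ x.2)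
    · obtain ⟨x, hx⟩ := x
      have hx' : (x : WithOne S.carrier) ^ n = a ^ n := hx
      obtain ⟨y, hy⟩ := exists_coe_eq_pow x (n := 2 * n - 1) (by omega)
      have hyH : y ∈ H := by
        change (y : WithOne S.carrier) ^ n = a ^ n
        rw [hy, ← pow_mul, mul_comm, pow_mul, hx']
        obtain ⟨k, hk⟩ := Nat.exists_eq_succ_of_ne_zero (show 2 * n - 1 ≠ 0 by omega)
        rw [hk]
        exact hidem.pow_succ_eq k
      have hxy : x * y = e := by
        rw [← WithOne.coe_inj, WithOne.coe_mul, hy, ← pow_succ',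
          show 2 * n - 1 + 1 = n + n by omega, pow_add, hx', hidem.eq, he]
      exact ⟨⟨y, hyH⟩, Subtype.ext hxy, Subtype.ext ((mul_comm _ _).trans hxy)⟩
  have hae : a = e := congrArg Subtype.val (hV T hT hG ⟨a, haH⟩ ⟨e, heH⟩)
  nth_rw 1 [hae]
  exact heq a haH

/-! ### Semilattices and nil-varieties -/

/-- The two-element semilattice. -/
abbrev semilatticeSG : ComSG :=
  @ComSG.mk Bool
    { mul := fun a b => a && b
      mul_assoc := Bool.and_assoc
      mul_comm := Bool.and_comm } ⟨true⟩

/-- The two-element null semigroup. -/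
abbrev nullSG : ComSG :=
  @ComSG.mk Bool
    { mul := fun _ _ => false
      mul_assoc := fun _ _ _ => rfl
      mul_comm := fun _ _ => rfl } ⟨true⟩

/-- The semigroup `{a, a², 0}`, with `0`, `1`, `2` standing for `0`, `a`, `a²`. -/
abbrev monogenicNilSG : ComSG :=
  @ComSG.mk (Fin 3)
    { mul := fun a b => if a = 1 ∧ b = 1 then 2 else 0
      mul_assoc := by decide
      mul_comm := by decide } ⟨0⟩

/-- The non-empty subsets of a three-element set, encoded as bit masks, together with the zero
element `0`: the product of two disjoint sets is their union, all other products are `0`. -/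
abbrev disjointUnionSG : ComSG :=
  @ComSG.mk (Fin 8)
    { mul := fun a b => if a &&& b = 0 ∧ a ≠ 0 ∧ b ≠ 0 then a ||| b else 0
      mul_assoc := by decide
      mul_comm := by decide } ⟨0⟩

theorem semilatticeSG_mem : semilatticeSG ∈ modelsOf SLvar.theory :=
  mem_models_SLvar.2 Bool.and_self

theorem SLvar_ne_bot : SLvar ≠ ⊥ :=
  ne_bot_iff.2 ⟨_, semilatticeSG_mem, true, false, Bool.noConfusion⟩

theorem not_SLvar_le_ZMvar : ¬ SLvar ≤ ZMvar := fun h =>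
  absurd (mem_models_ZMvar.1 (le_iff_models.1 h _ semilatticeSG_mem) true true false)
    Bool.noConfusion

theorem not_SLvar_le_Avar {n : ℕ} (hn : n ≠ 0) : ¬ SLvar ≤ Avar n := fun h => by
  have h1 := (mem_models_Avar hn).1 (le_iff_models.1 h _ semilatticeSG_mem)
  obtain ⟨c, hc⟩ := exists_coe_eq_pow (S := semilatticeSG.carrier) false hn
  have h2 : c * true = true := by
    rw [← WithOne.coe_inj, WithOne.coe_mul, hc]
    exact h1 false true
  have h3 : c = false := by
    obtain ⟨k, rfl⟩ := Nat.exists_eq_succ_of_ne_zero hn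
    have hidem : IsIdempotentElem ((false : semilatticeSG.carrier) :
        WithOne semilatticeSG.carrier) :=
      congrArg WithOne.coe (mem_models_SLvar.1 semilatticeSG_mem false)
    exact WithOne.coe_inj.1 (hc.trans (hidem.pow_succ_eq k))
  rw [h3] at h2
  exact Bool.noConfusion h2

theorem ZMvar_ne_bot : ZMvar ≠ ⊥ :=
  ne_bot_iff.2 ⟨nullSG, mem_models_ZMvar.2 fun _ _ _ => rfl, true, false, Bool.noConfusion⟩

theorem SLvar_isCombinatorial : IsCombinatorial SLvar := fun S hS hG a b => by
  let _ := hG.commGroup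
  have h : ∀ c : S.carrier, c = 1 := fun c =>
    mul_left_cancel ((mem_models_SLvar.1 hS c).trans (mul_one c).symm)
  rw [h a, h b]

theorem ZMvar_isCombinatorial : IsCombinatorial ZMvar := fun S hS hG a b => by
  let _ := hG.commGroup
  have h : ∀ c : S.carrier, c = 1 := fun c =>
    mul_left_cancel ((mem_models_ZMvar.1 hS 1 1 c).trans (mul_one _).symm)
  rw [h a, h b]

theorem pow_mul_add_one_eq {M : Type*} [Monoid M] {a : M} {n : ℕ} (h : a ^ (n + 1) = a) (k : ℕ) :
    a ^ (k * n + 1) = a := by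
  induction k with
  | zero => simp
  | succ k ih => rw [show (k + 1) * n + 1 = k * n + 1 + n by ring, pow_add, ih, ← pow_succ', h]

theorem ZMvar_le_of_ne_bot {V W : ComVariety} {k : ℕ}
    (hV : ∀ S ∈ modelsOf V.theory, ∀ a b : S.carrier,
      (a : WithOne S.carrier) ^ k * b = (a : WithOne S.carrier) ^ k)
    (hWV : W ≤ V) (hW : W ≠ ⊥) : ZMvar ≤ W := by
  by_contra hZ
  obtain ⟨n, hn, hp⟩ := exists_pow_of_not_ZMvar_le hZ
  obtain ⟨S, hS, a, b, hab⟩ := ne_bot_iff.1 hW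
  have hSV := hV S (le_iff_models.1 hWV S hS)
  have hpow : ∀ x : S.carrier, (x : WithOne S.carrier) = x ^ k := fun x => by
    obtain ⟨m, rfl⟩ := Nat.exists_eq_succ_of_ne_zero hn
    obtain ⟨c, hc⟩ := exists_coe_eq_pow x (k * m).succ_ne_zero
    have h1 := pow_mul_add_one_eq (hp S hS x) k
    rw [show k * (m + 1) + 1 = k + (k * m + 1) by ring, pow_add] at h1
    rw [← hSV x c, hc]
    exact h1.symm
  have hmul : ∀ x y : S.carrier, x * y = x := fun x y => by
    rw [← WithOne.coe_inj, WithOne.coe_mul, hpow x, hSV x y]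
  exact hab (by rw [← hmul a b, mul_comm, hmul b a])

theorem ZMvar_le_of_le_Nomegavar {W : ComVariety} (h : W ≤ Nomegavar) (hW : W ≠ ⊥) :
    ZMvar ≤ W := by
  refine ZMvar_le_of_ne_bot (k := 2) (fun S hS a b => ?_) h hW
  rw [pow_two, ← WithOne.coe_mul, ← WithOne.coe_mul, mem_models_Nomegavar.1 hS]

theorem ZMvar_le_of_le_N3cvar {W : ComVariety} (h : W ≤ N3cvar) (hW : W ≠ ⊥) :
    ZMvar ≤ W := by
  refine ZMvar_le_of_ne_bot (k := 3) (fun S hS a b => ?_) h hW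
  rw [pow_succ, pow_two, ← WithOne.coe_mul, ← WithOne.coe_mul, ← WithOne.coe_mul,
    mem_models_N3cvar.1 hS]

theorem not_Nomegavar_le_N3cvar : ¬ Nomegavar ≤ N3cvar := fun h => by
  have h1 : disjointUnionSG ∈ modelsOf Nomegavar.theory := mem_models_Nomegavar.2 (by decide)
  exact absurd (mem_models_N3cvar.1 (le_iff_models.1 h _ h1)
    (1 : Fin 8) (2 : Fin 8) (4 : Fin 8) (0 : Fin 8)) (by decide)

theorem not_N3cvar_le_Nomegavar : ¬ N3cvar ≤ Nomegavar := fun h => by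
  have h1 : monogenicNilSG ∈ modelsOf N3cvar.theory := mem_models_N3cvar.2 (by decide)
  exact absurd (mem_models_Nomegavar.1 (le_iff_models.1 h _ h1)
    (1 : Fin 3) (0 : Fin 3)) (by decide)

/-! ### A lattice-theoretic description of the atoms `Avar p` -/

/-- Every non-zero element below `v` lies above `a`. -/
def IsSoleAtomBelow {L : Type*} [Lattice L] (a v : L) : Prop :=
  ∀ w, w ≤ v → (∃ b, ¬ w ≤ b) → a ≤ w

/-- The non-zero element `a` is the sole atom below some strictly larger element, and the
elements below which `a` is the sole atom form a chain. -/
def IsChainAtom {L : Type*} [Lattice L] (a : L) : Prop :=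
  (∃ b, ¬ a ≤ b) ∧ (∃ v, IsSoleAtomBelow a v ∧ a ≤ v ∧ ¬ v ≤ a) ∧
    ∀ v w, IsSoleAtomBelow a v → IsSoleAtomBelow a w → v ≤ w ∨ w ≤ v

theorem exists_not_le_iff {V : ComVariety} : (∃ W, ¬ V ≤ W) ↔ V ≠ ⊥ := by
  rw [← not_forall, not_iff_not]
  exact ⟨fun h => le_bot_iff.1 (h ⊥), fun h W => h ▸ bot_le⟩

theorem exists_eq_Avar_prime_pow {p : ℕ} (hp : p.Prime) {V : ComVariety}
    (hV : IsSoleAtomBelow (Avar p) V) : ∃ k, V = Avar (p ^ k) := by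
  have hA := Avar_not_isCombinatorial hp.one_lt
  have hZ : ¬ ZMvar ≤ V := fun h =>
    hA (ZMvar_isCombinatorial.anti (hV _ h (exists_not_le_iff.2 ZMvar_ne_bot)))
  have hS : ¬ SLvar ≤ V := fun h =>
    hA (SLvar_isCombinatorial.anti (hV _ h (exists_not_le_iff.2 SLvar_ne_bot)))
  obtain ⟨d, hd, rfl⟩ := exists_eq_Avar_of_not_le hZ hS
  refine ⟨_, congrArg Avar (Nat.eq_prime_pow_of_unique_prime_dvd hd fun {q} hq hqd => ?_)⟩
  have h1 := hV _ ((Avar_le_Avar hq.ne_zero hd).2 hqd)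
    (exists_not_le_iff.2 (Avar_ne_bot hq.one_lt))
  exact ((Nat.prime_dvd_prime_iff_eq hp hq).1 ((Avar_le_Avar hp.ne_zero hq.ne_zero).1 h1)).symm

theorem Avar_prime_isChainAtom {p : ℕ} (hp : p.Prime) : IsChainAtom (Avar p) := by
  have hpk : ∀ k, p ^ k ≠ 0 := fun k => pow_ne_zero k hp.ne_zero
  refine ⟨exists_not_le_iff.2 (Avar_ne_bot hp.one_lt), ⟨Avar (p ^ 2), ?_, ?_, ?_⟩, ?_⟩
  · intro W hW hW0
    obtain ⟨d, hd, rfl⟩ := exists_eq_Avar (hpk 2) hW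
    obtain ⟨k, -, rfl⟩ := (Nat.dvd_prime_pow hp).1 ((Avar_le_Avar hd (hpk 2)).1 hW)
    refine (Avar_le_Avar hp.ne_zero (hpk k)).2 (dvd_pow_self p ?_)
    rintro rfl
    exact exists_not_le_iff.1 hW0 (by rw [pow_zero, Avar_one])
  · exact (Avar_le_Avar hp.ne_zero (hpk 2)).2 (dvd_pow_self p two_ne_zero)
  · rw [Avar_le_Avar (hpk 2) hp.ne_zero]
    intro h
    have h1 := Nat.le_of_dvd hp.pos h
    have h2 := hp.one_lt
    nlinarith
  · intro V W hV hW
    obtain ⟨k, rfl⟩ := exists_eq_Avar_prime_pow hp hV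
    obtain ⟨l, rfl⟩ := exists_eq_Avar_prime_pow hp hW
    rw [Avar_le_Avar (hpk k) (hpk l), Avar_le_Avar (hpk l) (hpk k)]
    exact (le_total k l).imp (pow_dvd_pow p) (pow_dvd_pow p)

theorem IsCombinatorial.not_isChainAtom {V : ComVariety} (hV : IsCombinatorial V) :
    ¬ IsChainAtom V := by
  rintro ⟨hV0, ⟨W, hW, hVW, hWV⟩, hchain⟩
  by_cases hZ : ZMvar ≤ V
  · have hVZ := hW _ (hZ.trans hVW) (exists_not_le_iff.2 ZMvar_ne_bot)
    rcases hchain Nomegavar N3cvar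
      (fun X hX h0 => hVZ.trans (ZMvar_le_of_le_Nomegavar hX (exists_not_le_iff.1 h0)))
      (fun X hX h0 => hVZ.trans (ZMvar_le_of_le_N3cvar hX (exists_not_le_iff.1 h0))) with h | h
    · exact not_Nomegavar_le_N3cvar h
    · exact not_N3cvar_le_Nomegavar h
  by_cases hS : SLvar ≤ V
  · have hVS := hW _ (hS.trans hVW) (exists_not_le_iff.2 SLvar_ne_bot)
    have hWcomb : IsCombinatorial W := (isCombinatorial_iff W).2 fun p hp hpW =>
      not_SLvar_le_Avar hp.ne_zero
        (hS.trans (hW _ hpW (exists_not_le_iff.2 (Avar_ne_bot hp.one_lt))))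
    have hWZ : ¬ ZMvar ≤ W := fun h =>
      not_SLvar_le_ZMvar (hS.trans (hW _ h (exists_not_le_iff.2 ZMvar_ne_bot)))
    exact hWV ((hWcomb.le_SLvar hWZ).trans hS)
  obtain ⟨d, hd, rfl⟩ := exists_eq_Avar_of_not_le hZ hS
  refine Avar_not_isCombinatorial ((Nat.one_lt_iff_ne_zero_and_ne_one).2 ⟨hd, ?_⟩) hV
  rintro rfl
  exact exists_not_le_iff.1 hV0 Avar_one

theorem isCombinatorial_iff_isChainAtom (V : ComVariety) :
    IsCombinatorial V ↔ ∀ W, W ≤ V → ¬ IsChainAtom W :=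
  ⟨fun h _ hW => (h.anti hW).not_isChainAtom,
    fun h => (isCombinatorial_iff V).2 fun _ hp hle => h _ hle (Avar_prime_isChainAtom hp)⟩

/-! ### The defining formula -/

/-- The term `s ∨ t`. -/
def joinTerm {α : Type} (s t : latticeLang.Term α) : latticeLang.Term α :=
  Language.Functions.apply₂ (show latticeLang.Functions 2 from true) s t

/-- The formula `s ≤ t`. -/
def leFormula {n : ℕ} (s t : latticeLang.Term (Fin 1 ⊕ Fin n)) :
    latticeLang.BoundedFormula (Fin 1) n :=
  (joinTerm s t).bdEqual t

/-- The bound variable with the given index, as a term. -/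
def bvar {n : ℕ} (i : Fin n) : latticeLang.Term (Fin 1 ⊕ Fin n) := Language.Term.var (Sum.inr i)

/-- The formula stating that the variable `i` is not the least element. -/
def neBotFormula {n : ℕ} (i : Fin n) : latticeLang.BoundedFormula (Fin 1) n :=
  ∃' ∼(leFormula (bvar i.castSucc) (bvar (Fin.last n)))

/-- The formula expressing `IsSoleAtomBelow`. -/
def soleAtomFormula {n : ℕ} (a v : Fin n) : latticeLang.BoundedFormula (Fin 1) n :=
  ∀' (leFormula (bvar (Fin.last n)) (bvar v.castSucc) ⟹ neBotFormula (Fin.last n) ⟹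
    leFormula (bvar a.castSucc) (bvar (Fin.last n)))

/-- The formula expressing `IsChainAtom`. -/
def chainAtomFormula : latticeLang.BoundedFormula (Fin 1) 1 :=
  neBotFormula 0 ⊓
    (∃' (soleAtomFormula 0 1 ⊓ leFormula (bvar 0) (bvar 1) ⊓ ∼(leFormula (bvar 1) (bvar 0)))) ⊓
    ∀' ∀' (soleAtomFormula (n := 3) 0 1 ⟹ soleAtomFormula 0 2 ⟹
      leFormula (bvar 1) (bvar 2) ⊔ leFormula (bvar 2) (bvar 1))

section Realize

variable {L : Type*} [Lattice L] {n : ℕ} (x : Fin 1 → L) (xs : Fin n → L)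

theorem realize_leFormula (s t : latticeLang.Term (Fin 1 ⊕ Fin n)) :
    (leFormula s t).Realize x xs ↔
      s.realize (Sum.elim x xs) ≤ t.realize (Sum.elim x xs) := by
  rw [leFormula, Language.BoundedFormula.realize_bdEqual, joinTerm,
    Language.Term.realize_functions_apply₂, ← sup_eq_right]
  rfl

theorem realize_bvar (i : Fin n) : (bvar i).realize (Sum.elim x xs) = xs i := rfl

theorem realize_neBotFormula (i : Fin n) :
    (neBotFormula i).Realize x xs ↔ ∃ b, ¬ xs i ≤ b := by
  simp [neBotFormula, realize_leFormula, realize_bvar]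

theorem realize_soleAtomFormula (a v : Fin n) :
    (soleAtomFormula a v).Realize x xs ↔ IsSoleAtomBelow (xs a) (xs v) := by
  simp [soleAtomFormula, IsSoleAtomBelow, realize_leFormula, realize_bvar, realize_neBotFormula]

theorem realize_chainAtomFormula (a : L) :
    chainAtomFormula.Realize x (Fin.snoc default a) ↔ IsChainAtom a := by
  simp [chainAtomFormula, IsChainAtom, realize_leFormula, realize_bvar, realize_neBotFormula,
    realize_soleAtomFormula, Fin.snoc, and_assoc]

end Realize

/-- **Theorem.** The set of all combinatorial commutative semigroup varieties is
definable in the lattice **Com**; moreover, a commutative semigroup variety is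
combinatorial if and only if it does not contain the variety `A p` for any prime `p`. -/
theorem definable_combinatorial_varieties :
    LatDefinable ComVariety {V : ComVariety | IsCombinatorial V} ∧
    (∀ V : ComVariety, IsCombinatorial V ↔ ∀ p : ℕ, p.Prime → ¬ Avar p ≤ V) := by
  refine ⟨⟨∀' (leFormula (bvar 0) (Language.Term.var (Sum.inl 0)) ⟹ ∼chainAtomFormula),
    fun V => ?_⟩, isCombinatorial_iff⟩
  rw [Set.mem_ofPred_eq, isCombinatorial_iff_isChainAtom, Language.Formula.Realize]
  simp [realize_leFormula, realize_bvar, realize_chainAtomFormula, Fin.snoc]
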